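/- Let P = {h : D → ℂ | h(x) = exp(⟨u_I, x_I⟩)·∫_{ℝ^n} exp(i⟨y, x_J⟩)g(y) dy, Re u_I < 0, g ∈ C_c^∞(ℝ^n)} on D = ℝ≥0^m × ℝ^n. Then the linear span of P is dense in C₀(D) (continuous functions vanishing at infinity) with respect to the supremum norm. -/

import Mathlib

open Complex MeasureTheory ZeroAtInfty

open Filter Topology in
/-- Extension of a `C₀` function by `0` at infinity. -/
noncomputable def extZero {X : Type*} [TopologicalSpace X] [T2Space X] (f : C₀(X, ℂ)) :
    C(OnePoint X, ℂ) :=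
  OnePoint.continuousMapMk f.toContinuousMap 0 (by
    rw [coclosedCompact_eq_cocompact]; exact f.zero_at_infty')

theorem extZero_coe {X : Type*} [TopologicalSpace X] [T2Space X] (f : C₀(X, ℂ)) (x : X) :
    extZero f (x : OnePoint X) = f x := rfl

theorem extZero_infty {X : Type*} [TopologicalSpace X] [T2Space X] (f : C₀(X, ℂ)) :
    extZero f (OnePoint.infty) = 0 := rfl

/-- The unitization inside `C(OnePoint X, ℂ)`. -/
noncomputable def unitizationAlg {X : Type*} [TopologicalSpace X] [T2Space X]
    (S : Submodule ℂ C₀(X, ℂ)) (hmul : ∀ f ∈ S, ∀ g ∈ S, f * g ∈ S)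
    (hstar : ∀ f ∈ S, star f ∈ S) : StarSubalgebra ℂ C(OnePoint X, ℂ) where
  carrier := {f | ∃ c : ℂ, ∃ a ∈ S, ∀ x, f x = c + extZero a x}
  mul_mem' := by
    rintro f g ⟨c, a, ha, hf⟩ ⟨d, b, hb, hg⟩
    refine ⟨c * d, c • b + d • a + a * b,
      S.add_mem (S.add_mem (S.smul_mem _ hb) (S.smul_mem _ ha)) (hmul _ ha _ hb), ?_⟩
    rw [OnePoint.forall]
    constructor
    · simp [hf, hg, extZero_infty]
    · intro x
      simp [hf, hg, extZero_coe]
      ring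
  add_mem' := by
    rintro f g ⟨c, a, ha, hf⟩ ⟨d, b, hb, hg⟩
    refine ⟨c + d, a + b, S.add_mem ha hb, ?_⟩
    rw [OnePoint.forall]
    constructor
    · simp [hf, hg, extZero_infty]
    · intro x
      simp [hf, hg, extZero_coe]
      ring
  algebraMap_mem' := by
    intro c
    refine ⟨c, 0, S.zero_mem, ?_⟩
    rw [OnePoint.forall]
    constructor
    · simp [extZero_infty]
    · intro x
      simp [extZero_coe]
  star_mem' := by
    rintro f ⟨c, a, ha, hf⟩
    refine ⟨star c, star a, hstar _ ha, ?_⟩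
    rw [OnePoint.forall]
    constructor
    · simp [hf, extZero_infty]
    · intro x
      simp [hf, extZero_coe]

theorem dense_of_separates {X : Type*} [TopologicalSpace X] [T2Space X]
    (P : Set C₀(X, ℂ)) (hmul : ∀ f ∈ P, ∀ g ∈ P, f * g ∈ P)
    (hstar : ∀ f ∈ P, star f ∈ P) (hne : ∀ x, ∃ f ∈ P, f x ≠ 0)
    (hsep : ∀ x y, x ≠ y → ∃ f ∈ P, f x ≠ f y) :
    Dense (Submodule.span ℂ P : Set C₀(X, ℂ)) := by
  have hmul' : ∀ f ∈ Submodule.span ℂ P, ∀ g ∈ Submodule.span ℂ P, f * g ∈ Submodule.span ℂ P := by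
    intro f hf g hg
    induction hf, hg using Submodule.span_induction₂ with
    | mem_mem x y hx hy => exact Submodule.subset_span (hmul _ hx _ hy)
    | zero_left y hy => simp
    | zero_right x hx => simp
    | add_left x y z _ _ _ h1 h2 => rw [add_mul]; exact add_mem h1 h2
    | add_right x y z _ _ _ h1 h2 => rw [mul_add]; exact add_mem h1 h2
    | smul_left r x y _ _ h => rw [smul_mul_assoc]; exact Submodule.smul_mem _ _ h
    | smul_right r x y _ _ h => rw [mul_smul_comm]; exact Submodule.smul_mem _ _ h
  have hstar' : ∀ f ∈ Submodule.span ℂ P, star f ∈ Submodule.span ℂ P := by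
    intro f hf
    induction hf using Submodule.span_induction with
    | mem x hx => exact Submodule.subset_span (hstar _ hx)
    | zero => simp
    | add x y _ _ h1 h2 => rw [star_add]; exact add_mem h1 h2
    | smul r x _ h => rw [star_smul]; exact Submodule.smul_mem _ _ h
  set A := unitizationAlg (Submodule.span ℂ P) hmul' hstar' with hA
  have hext : ∀ f ∈ P, extZero f ∈ A := fun f hf =>
    ⟨0, f, Submodule.subset_span hf, by simp⟩
  have hs : A.SeparatesPoints := by
    have key : ∀ x y : OnePoint X, x ≠ y → ∃ f ∈ P, extZero f x ≠ extZero f y := by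
      rw [OnePoint.forall]
      constructor
      · rw [OnePoint.forall]
        refine ⟨fun h => (h rfl).elim, fun y _ => ?_⟩
        obtain ⟨f, hf, h⟩ := hne y
        exact ⟨f, hf, fun h' => h h'.symm⟩
      · intro x
        rw [OnePoint.forall]
        refine ⟨fun _ => ?_, fun y hxy => ?_⟩
        · obtain ⟨f, hf, h⟩ := hne x
          exact ⟨f, hf, h⟩
        · obtain ⟨f, hf, h⟩ := hsep x y (fun h => hxy (by rw [h]))
          exact ⟨f, hf, h⟩
    intro x y hxy
    obtain ⟨f, hf, h⟩ := key x y hxy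
    exact ⟨extZero f, ⟨extZero f, hext f hf, rfl⟩, h⟩
  have htop := ContinuousMap.starSubalgebra_topologicalClosure_eq_top_of_separatesPoints A hs
  rw [Metric.dense_iff]
  intro f ε hε
  have hmem : extZero f ∈ closure (A : Set C(OnePoint X, ℂ)) := by
    rw [← StarSubalgebra.topologicalClosure_coe, htop]; trivial
  obtain ⟨b, ⟨c, a, ha, hb⟩, hd⟩ := Metric.mem_closure_iff.1 hmem (ε / 3) (by positivity)
  refine ⟨a, ?_, ha⟩
  have hpt := fun x => (ContinuousMap.dist_apply_le_dist (f := extZero f) (g := b) x).trans hd.le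
  have hc : ‖c‖ ≤ ε / 3 := by
    have := hpt OnePoint.infty
    simpa [hb, extZero_infty] using this
  rw [Metric.mem_ball, dist_comm, ← ZeroAtInftyContinuousMap.dist_toBCF_eq_dist]
  refine lt_of_le_of_lt ((BoundedContinuousFunction.dist_le (C := 2 * ε / 3) (by positivity)).2 ?_) (by linarith)
  intro x
  have := hpt x
  rw [hb, extZero_coe, extZero_coe, dist_eq_norm] at this
  change dist (f x) (a x) ≤ _
  rw [dist_eq_norm]
  calc ‖f x - a x‖ = ‖(f x - (c + a x)) + c‖ := by congr 1; ring
    _ ≤ ‖f x - (c + a x)‖ + ‖c‖ := norm_add_le _ _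
    _ ≤ _ := by linarith

/-- The Fourier-type integral. -/
noncomputable def ftI {n : ℕ} (g : (Fin n → ℝ) → ℂ) (x : Fin n → ℝ) : ℂ :=
  ∫ y : Fin n → ℝ, Complex.exp (Complex.I * (∑ j, (y j : ℂ) * (x j : ℂ))) * g y

theorem ftI_integrable {n : ℕ} {g : (Fin n → ℝ) → ℂ} (hg : Continuous g)
    (hc : HasCompactSupport g) (x : Fin n → ℝ) :
    Integrable (fun y : Fin n → ℝ =>
      Complex.exp (Complex.I * (∑ j, (y j : ℂ) * (x j : ℂ))) * g y) := by
  apply Continuous.integrable_of_hasCompactSupport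
  · fun_prop
  · exact hc.mul_left

theorem ftI_continuous {n : ℕ} {g : (Fin n → ℝ) → ℂ} (hg : Continuous g)
    (hc : HasCompactSupport g) : Continuous (ftI g) := by
  refine continuous_of_dominated (bound := fun y => ‖g y‖) ?_ ?_ ?_ ?_
  · intro x
    exact (ftI_integrable hg hc x).aestronglyMeasurable
  · intro x
    refine .of_forall fun y => ?_
    rw [norm_mul]
    have : Complex.I * (∑ j, (y j : ℂ) * (x j : ℂ)) = ((∑ j, y j * x j : ℝ) : ℂ) * Complex.I := by
      push_cast; ring
    rw [this, Complex.norm_exp_ofReal_mul_I, one_mul]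
  · exact (hg.integrable_of_hasCompactSupport hc).norm
  · refine .of_forall fun y => ?_
    fun_prop

open Filter Topology in
theorem ftI_tendsto {n : ℕ} (g : (Fin n → ℝ) → ℂ) :
    Tendsto (ftI g) (cocompact (Fin n → ℝ)) (𝓝 0) := by
  have h := tendsto_integral_exp_smul_cocompact g (volume : Measure (Fin n → ℝ))
  have hne : (-(1 / (2 * Real.pi)) : ℝ) ≠ 0 := by
    have := Real.pi_pos
    simp [this.ne']
  let e : (Fin n → ℝ) ≃ₗ[ℝ] StrongDual ℝ (Fin n → ℝ) :=
    (LinearEquiv.smulOfNeZero ℝ (Fin n → ℝ) _ hne).trans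
      ((dotProductEquiv ℝ (Fin n)).trans LinearMap.toContinuousLinearMap)
  have he : Tendsto e (cocompact _) (cocompact _) :=
    e.toContinuousLinearEquiv.toHomeomorph.isClosedEmbedding.tendsto_cocompact
  refine (h.comp he).congr fun x => ?_
  simp only [Function.comp, ftI]
  congr 1
  ext y
  have : e x y = -(1 / (2 * Real.pi)) * ∑ j, x j * y j := by
    simp [e, dotProduct, Finset.mul_sum, mul_assoc]
  rw [this, Circle.smul_def, Real.fourierChar_apply, smul_eq_mul]
  congr 2
  have hpi : (Real.pi : ℂ) ≠ 0 := by exact_mod_cast Real.pi_ne_zero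
  push_cast
  field_simp
  simp [mul_comm]

open scoped Convolution in
theorem ftI_mul {n : ℕ} {g₁ g₂ : (Fin n → ℝ) → ℂ} (h₁ : Continuous g₁)
    (c₁ : HasCompactSupport g₁) (h₂ : Continuous g₂) (c₂ : HasCompactSupport g₂)
    (x : Fin n → ℝ) :
    ftI g₁ x * ftI g₂ x = ftI (g₁ ⋆[ContinuousLinearMap.mul ℝ ℂ, volume] g₂) x := by
  have := integral_convolution (L := ContinuousLinearMap.mul ℝ ℂ) (μ := volume) (ν := volume)
    (ftI_integrable h₁ c₁ x) (ftI_integrable h₂ c₂ x)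
  rw [ContinuousLinearMap.mul_apply'] at this
  rw [ftI, ftI, ← this, ftI]
  congr 1
  ext y
  simp only [convolution_def, ContinuousLinearMap.mul_apply']
  rw [← integral_const_mul]
  congr 1
  ext t
  have : Complex.exp (Complex.I * (∑ j, (y j : ℂ) * (x j : ℂ))) =
    Complex.exp (Complex.I * (∑ j, (t j : ℂ) * (x j : ℂ))) *
    Complex.exp (Complex.I * (∑ j, ((y - t) j : ℂ) * (x j : ℂ))) := by
    rw [← Complex.exp_add, ← mul_add, ← Finset.sum_add_distrib]
    congr 3
    ext j
    simp
    ring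
  rw [this]
  ring

theorem ftI_star {n : ℕ} (g : (Fin n → ℝ) → ℂ) (x : Fin n → ℝ) :
    star (ftI g x) = ftI (fun y => star (g (-y))) x := by
  simp only [ftI]
  rw [← integral_neg_eq_self]
  change (starRingEnd ℂ) _ = _
  rw [← integral_conj]
  congr 1
  ext y
  rw [map_mul, ← Complex.exp_conj]
  simp

theorem ftI_eq_zero {n : ℕ} (c d : ℂ) (a b : Fin n → ℝ)
    (h : ∀ g : (Fin n → ℝ) → ℂ, ContDiff ℝ (⊤ : ℕ∞) g → HasCompactSupport g →
      c * ftI g a = d * ftI g b) (y : Fin n → ℝ) :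
    c * Complex.exp (Complex.I * (∑ j, (y j : ℂ) * (a j : ℂ))) =
      d * Complex.exp (Complex.I * (∑ j, (y j : ℂ) * (b j : ℂ))) := by
  let F : (Fin n → ℝ) → ℂ := fun y =>
    c * Complex.exp (Complex.I * (∑ j, (y j : ℂ) * (a j : ℂ))) -
      d * Complex.exp (Complex.I * (∑ j, (y j : ℂ) * (b j : ℂ)))
  have hF : Continuous F := by fun_prop
  have h0 : ∀ᵐ y, F y = 0 := by
    apply ae_eq_zero_of_integral_contDiff_smul_eq_zero hF.locallyIntegrable
    intro g hg hc
    have hg' : ContDiff ℝ (⊤ : ℕ∞) (fun y => (g y : ℂ)) := Complex.ofRealCLM.contDiff.comp hg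
    have hc' : HasCompactSupport (fun y => (g y : ℂ)) := hc.comp_left (g := Complex.ofReal) rfl
    have := h _ hg' hc'
    rw [← sub_eq_zero, ftI, ftI, ← integral_const_mul, ← integral_const_mul, ← integral_sub
      ((ftI_integrable hg'.continuous hc' a).const_mul c)
      ((ftI_integrable hg'.continuous hc' b).const_mul d)] at this
    rw [← this]
    congr 1
    ext y
    simp only [F, Complex.real_smul]
    ring
  have h1 : F = fun _ => 0 := (hF.ae_eq_iff_eq volume continuous_const).1 h0
  exact sub_eq_zero.1 (congrFun h1 y)

open Filter Topology in
theorem exp_abs_tendsto {m : ℕ} (u : Fin m → ℝ) (hu : ∀ i, u i ≤ -1) :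
    Tendsto (fun x : Fin m → ℝ => Complex.exp (∑ i, (u i : ℂ) * ((|x i| : ℝ) : ℂ)))
      (cocompact (Fin m → ℝ)) (𝓝 0) := by
  rw [tendsto_zero_iff_norm_tendsto_zero]
  have h : Tendsto (fun x : Fin m → ℝ => Real.exp (-‖x‖)) (cocompact (Fin m → ℝ)) (𝓝 0) :=
    Real.tendsto_exp_neg_atTop_nhds_zero.comp (tendsto_norm_cocompact_atTop)
  refine squeeze_zero (fun _ => norm_nonneg _) (fun x => ?_) h
  rw [Complex.norm_exp]
  apply Real.exp_le_exp.2
  have : (∑ i, (u i : ℂ) * ((|x i| : ℝ) : ℂ)) = ((∑ i, u i * |x i| : ℝ) : ℂ) := by push_cast; rfl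
  rw [this, Complex.ofReal_re]
  have h1 : ∑ i, u i * |x i| ≤ ∑ i, -|x i| := by
    apply Finset.sum_le_sum
    intro i _
    nlinarith [hu i, abs_nonneg (x i)]
  have h2 : ‖x‖ ≤ ∑ i, |x i| := by
    rw [pi_norm_le_iff_of_nonneg (Finset.sum_nonneg fun i _ => abs_nonneg _)]
    intro i
    exact Finset.single_le_sum (f := fun i => |x i|) (fun i _ => abs_nonneg _) (Finset.mem_univ i)
  rw [Finset.sum_neg_distrib] at h1
  linarith

open Filter Topology in
theorem exists_elem {m n : ℕ} (D : Set ((Fin m → ℝ) × (Fin n → ℝ)))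
    (hD : D = {x | ∀ i : Fin m, 0 ≤ x.1 i}) (u : Fin m → ℝ) (hu : ∀ i, u i ≤ -1)
    (g : (Fin n → ℝ) → ℂ) (hg : Continuous g) (hc : HasCompactSupport g) :
    ∃ h : C₀(D, ℂ), ∀ x : D, h x =
      Complex.exp (∑ i, (u i : ℂ) * ((x : (Fin m → ℝ) × (Fin n → ℝ)).1 i : ℂ)) *
        ftI g (x : (Fin m → ℝ) × (Fin n → ℝ)).2 := by
  have hcl : IsClosed D := by
    rw [hD]
    simp only [Set.ofPred_forall]
    exact isClosed_iInter fun i => isClosed_le continuous_const (by fun_prop)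
  have hE : Continuous (fun x : Fin m → ℝ =>
      Complex.exp (∑ i, (u i : ℂ) * ((|x i| : ℝ) : ℂ))) := by fun_prop
  have ht := tendsto_mul_cocompact_nhds_zero hE (ftI_continuous hg hc)
    (exp_abs_tendsto u hu) (ftI_tendsto g)
  have hcont : Continuous (fun i : (Fin m → ℝ) × (Fin n → ℝ) =>
      Complex.exp (∑ k, (u k : ℂ) * ((|i.1 k| : ℝ) : ℂ)) * ftI g i.2) :=
    (hE.comp continuous_fst).mul ((ftI_continuous hg hc).comp continuous_snd)
  refine ⟨⟨⟨fun x : D => _, hcont.comp continuous_subtype_val⟩,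
    ht.comp hcl.isClosedEmbedding_subtypeVal.tendsto_cocompact⟩, fun x => ?_⟩
  have hx : ∀ i, 0 ≤ (x : (Fin m → ℝ) × (Fin n → ℝ)).1 i := by
    exact hD.le x.2
  change Complex.exp (∑ k, (u k : ℂ) * ((|x.1.1 k| : ℝ) : ℂ)) * ftI g x.1.2 = _
  simp only [abs_of_nonneg (hx _)]

theorem stmt14 (m n : ℕ)
    (D : Set ((Fin m → ℝ) × (Fin n → ℝ)))
    (hD : D = {x | ∀ i : Fin m, 0 ≤ x.1 i})
    (P : Set (C₀(D, ℂ)))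
    (hP : P = {h : C₀(D, ℂ) |
      ∃ uI : Fin m → ℂ, (∀ i, (uI i).re < 0) ∧
      ∃ g : (Fin n → ℝ) → ℂ, ContDiff ℝ (⊤ : ℕ∞) g ∧ HasCompactSupport g ∧
        ∀ x : D, h x = Complex.exp (∑ i, uI i * ((x : (Fin m → ℝ) × (Fin n → ℝ)).1 i : ℂ)) *
          ∫ y : Fin n → ℝ, Complex.exp (Complex.I *
            (∑ j, (y j : ℂ) * ((x : (Fin m → ℝ) × (Fin n → ℝ)).2 j : ℂ))) * g y}) :
    Dense (Submodule.span ℂ P : Set (C₀(D, ℂ))) := by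
  have hmem : ∀ h : C₀(D, ℂ), h ∈ P ↔ ∃ uI : Fin m → ℂ, (∀ i, (uI i).re < 0) ∧
      ∃ g : (Fin n → ℝ) → ℂ, ContDiff ℝ (⊤ : ℕ∞) g ∧ HasCompactSupport g ∧
        ∀ x : D, h x = Complex.exp (∑ i, uI i * ((x : (Fin m → ℝ) × (Fin n → ℝ)).1 i : ℂ)) *
          ftI g (x : (Fin m → ℝ) × (Fin n → ℝ)).2 := by
    intro h
    rw [hP]
    rfl
  have hex : ∀ u : Fin m → ℝ, (∀ i, u i ≤ -1) → ∀ g : (Fin n → ℝ) → ℂ,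
      ContDiff ℝ (⊤ : ℕ∞) g → HasCompactSupport g → ∃ h ∈ P, ∀ x : D, h x =
      Complex.exp (∑ i, (u i : ℂ) * ((x : (Fin m → ℝ) × (Fin n → ℝ)).1 i : ℂ)) *
        ftI g (x : (Fin m → ℝ) × (Fin n → ℝ)).2 := by
    intro u hu g hg hc
    obtain ⟨h, hh⟩ := exists_elem D hD u hu g hg.continuous hc
    refine ⟨h, (hmem h).2 ⟨fun i => (u i : ℂ), fun i => ?_, g, hg, hc, hh⟩, hh⟩
    rw [Complex.ofReal_re]
    linarith [hu i]
  clear hP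
  apply dense_of_separates
  · intro f hf f' hf'
    rw [hmem] at hf hf' ⊢
    obtain ⟨u, hu, g, hg, hc, h⟩ := hf
    obtain ⟨u', hu', g', hg', hc', h'⟩ := hf'
    refine ⟨u + u', fun i => ?_, _,
      hc'.contDiff_convolution_right (ContinuousLinearMap.mul ℝ ℂ) (μ := volume)
        hg.continuous.locallyIntegrable hg', hc.convolution _ hc', fun x => ?_⟩
    · simpa using add_neg (hu i) (hu' i)
    · rw [← ftI_mul hg.continuous hc hg'.continuous hc', ZeroAtInftyContinuousMap.mul_apply, h, h']
      simp only [Pi.add_apply, add_mul, Finset.sum_add_distrib, Complex.exp_add]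
      ring
  · intro f hf
    rw [hmem] at hf ⊢
    obtain ⟨u, hu, g, hg, hc, h⟩ := hf
    refine ⟨fun i => star (u i), fun i => by simpa using hu i, fun y => star (g (-y)),
      ?_, ?_, fun x => ?_⟩
    · exact Complex.conjCLE.contDiff.comp (hg.comp contDiff_neg)
    · exact (hc.comp_homeomorph (Homeomorph.neg _)).comp_left (g := star) (star_zero _)
    · rw [← ftI_star, ZeroAtInftyContinuousMap.star_apply, h, star_mul']
      congr 1
      change (starRingEnd ℂ) _ = _
      rw [← Complex.exp_conj]
      simp
  · intro x
    by_contra! H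
    have := ftI_eq_zero
      (Complex.exp (∑ i, ((-1 : ℝ) : ℂ) * ((x : (Fin m → ℝ) × (Fin n → ℝ)).1 i : ℂ))) 0 x.1.2 x.1.2
      (fun g hg hc => by
        obtain ⟨h, hh, hx⟩ := hex (fun _ => -1) (fun _ => le_rfl) g hg hc
        rw [← hx, H h hh, zero_mul]) 0
    rw [zero_mul, mul_eq_zero] at this
    exact this.elim (Complex.exp_ne_zero _) (Complex.exp_ne_zero _)
  · intro x y hxy
    by_contra! H
    have key : ∀ u : Fin m → ℝ, (∀ i, u i ≤ -1) → ∀ z : Fin n → ℝ,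
        Complex.exp (∑ i, (u i : ℂ) * (x.1.1 i : ℂ)) *
          Complex.exp (Complex.I * (∑ j, (z j : ℂ) * (x.1.2 j : ℂ))) =
        Complex.exp (∑ i, (u i : ℂ) * (y.1.1 i : ℂ)) *
          Complex.exp (Complex.I * (∑ j, (z j : ℂ) * (y.1.2 j : ℂ))) := by
      intro u hu
      apply ftI_eq_zero
      intro g hg hc
      obtain ⟨h, hh, hx⟩ := hex u hu g hg hc
      rw [← hx, ← hx, H h hh]
    have key1 : ∀ u : Fin m → ℝ, (∀ i, u i ≤ -1) →
        ∑ i, u i * x.1.1 i = ∑ i, u i * y.1.1 i := by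
      intro u hu
      have := key u hu 0
      simp only [Pi.zero_apply, Complex.ofReal_zero, zero_mul, Finset.sum_const_zero, mul_zero,
        Complex.exp_zero, mul_one] at this
      apply Real.exp_injective
      apply Complex.ofReal_injective
      push_cast
      exact this
    apply hxy
    apply Subtype.ext
    apply Prod.ext
    · ext i
      have h1 := key1 (fun _ => -1) (fun _ => le_rfl)
      have h2 := key1 (fun k => -1 + (if k = i then -1 else 0)) (fun k => by split_ifs <;> norm_num)
      simp only [add_mul, Finset.sum_add_distrib, ite_mul, zero_mul, Finset.sum_ite_eq',
        Finset.mem_univ, if_true] at h2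
      linarith
    · ext j
      by_contra hj
      have hs : x.1.2 j - y.1.2 j ≠ 0 := sub_ne_zero.2 hj
      have h1 := key (fun _ => -1) (fun _ => le_rfl) (Pi.single j (Real.pi / (x.1.2 j - y.1.2 j)))
      have h2 := key1 (fun _ => -1) (fun _ => le_rfl)
      have h3 : ∑ i, (((-1 : ℝ)) : ℂ) * (x.1.1 i : ℂ) = ∑ i, (((-1 : ℝ)) : ℂ) * (y.1.1 i : ℂ) := by
        exact_mod_cast h2
      rw [h3] at h1
      have h4 := mul_left_cancel₀ (Complex.exp_ne_zero _) h1
      have h5 : ∀ w : Fin n → ℝ, ∑ k, ((Pi.single j (Real.pi / (x.1.2 j - y.1.2 j)) :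
          Fin n → ℝ) k : ℂ) * (w k : ℂ) = ((Real.pi / (x.1.2 j - y.1.2 j) * w j : ℝ) : ℂ) := by
        intro w
        rw [Finset.sum_eq_single j]
        · simp
        · intro k _ hk
          simp [hk]
        · simp
      rw [h5, h5] at h4
      have h6 : Complex.I * ((Real.pi / (x.1.2 j - y.1.2 j) * x.1.2 j : ℝ) : ℂ) =
          Real.pi * Complex.I + Complex.I * ((Real.pi / (x.1.2 j - y.1.2 j) * y.1.2 j : ℝ) : ℂ) := by
        have : (Real.pi / (x.1.2 j - y.1.2 j) * x.1.2 j : ℝ) =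
          Real.pi + Real.pi / (x.1.2 j - y.1.2 j) * y.1.2 j := by
          field_simp
          ring
        rw [this]
        push_cast
        ring
      rw [h6, Complex.exp_add, Complex.exp_pi_mul_I] at h4
      have h7 := Complex.exp_ne_zero
        (Complex.I * ((Real.pi / (x.1.2 j - y.1.2 j) * y.1.2 j : ℝ) : ℂ))
      apply h7
      linear_combination (-1 / 2 : ℂ) * h4
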